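/- Let f := (z₁ − 2)² − (z₂ − 3)²(z₃ − 5) ∈ ℂ[z₁,z₂,z₃]. For generic u ∈ ℂ³, the set {z ∈ (ℂ*)³ : f(z) = 0 and there exists λ ∈ ℂ with u_i = λ·z_i·(∂f/∂z_i)(z) for i = 1,2,3} has exactly 3 elements. (The ML degree of the shifted Whitney umbrella is r₀ = 3.) -/

import Mathlib

open MvPolynomial

/-- The shifted Whitney umbrella `(z₁ − 2)² − (z₂ − 3)²(z₃ − 5)`. -/
noncomputable def umbrella : MvPolynomial (Fin 3) ℂ :=
  (X 0 - 2) ^ 2 - (X 1 - 3) ^ 2 * (X 2 - 5)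

/-- The cubic whose roots are the slopes `(z₁ - 2) / (z₂ - 3)` of the ML-critical points
for the data `(a, b, c)`. -/
def slopeCubic {R : Type*} [CommRing R] (a b c : R) : Cubic R :=
  ⟨3 * a + 6 * c, 2 * b - 4 * c, 15 * a, 10 * b⟩

/-- The value of `z₂ - 3` at the ML-critical point of slope `t`. -/
noncomputable def offset (a b t : ℂ) : ℂ := -(3 * a * t + 2 * b) / ((a + b) * t)

/-- The ML-critical point of slope `t`. -/
noncomputable def criticalPoint (a b t : ℂ) : Fin 3 → ℂ :=
  ![2 + t * offset a b t, 3 + offset a b t, 5 + t ^ 2]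

theorem eval_umbrella (z : Fin 3 → ℂ) :
    eval z umbrella = (z 0 - 2) ^ 2 - (z 1 - 3) ^ 2 * (z 2 - 5) := by
  simp [umbrella]

theorem eval_pderiv_umbrella (z : Fin 3 → ℂ) :
    eval z (pderiv 0 umbrella) = 2 * (z 0 - 2) ∧
    eval z (pderiv 1 umbrella) = -(2 * (z 1 - 3) * (z 2 - 5)) ∧
    eval z (pderiv 2 umbrella) = -(z 1 - 3) ^ 2 := by
  have h2 (i : Fin 3) : pderiv i (2 : MvPolynomial (Fin 3) ℂ) = 0 := pderiv_C (a := (2 : ℂ))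
  have h3 (i : Fin 3) : pderiv i (3 : MvPolynomial (Fin 3) ℂ) = 0 := pderiv_C (a := (3 : ℂ))
  have h5 (i : Fin 3) : pderiv i (5 : MvPolynomial (Fin 3) ℂ) = 0 := pderiv_C (a := (5 : ℂ))
  refine ⟨?_, ?_, ?_⟩ <;>
    simp [umbrella, Derivation.leibniz_pow, pderiv_X, h2, h3, h5]
  ring

/-- A root of the slope cubic avoids every value at which the critical point degenerates. -/
theorem slope_nondegenerate {a b c t : ℂ} (hb : b ≠ 0) (hc : c ≠ 0) (hab : a + b ≠ 0)
    (ht : (3 * a + 6 * c) * t ^ 3 + (2 * b - 4 * c) * t ^ 2 + 15 * a * t + 10 * b = 0) :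
    t ≠ 0 ∧ 3 * t - 2 ≠ 0 ∧ 3 * a * t + 2 * b ≠ 0 ∧ 5 + t ^ 2 ≠ 0 := by
  have h0 : t ≠ 0 := by
    rintro rfl
    exact hb (by linear_combination ht / 10)
  have h23 : 3 * t - 2 ≠ 0 := fun h => by
    obtain rfl : t = 2 / 3 := by linear_combination h / 3
    exact hab (by linear_combination 9 / 98 * ht)
  have hprod : 2 * c * t ^ 2 * (3 * t - 2) ≠ 0 := by simp [hc, h0, h23]
  refine ⟨h0, h23, fun h => hprod ?_, fun h => hprod ?_⟩
  · linear_combination ht - (5 + t ^ 2) * h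
  · linear_combination ht - (3 * a * t + 2 * b) * h

theorem offset_ne_zero {a b t : ℂ} (hab : a + b ≠ 0) (h0 : t ≠ 0)
    (h : 3 * a * t + 2 * b ≠ 0) : offset a b t ≠ 0 :=
  div_ne_zero (neg_ne_zero.mpr h) (mul_ne_zero hab h0)

theorem criticalPoint_slope {a b t : ℂ} (h : offset a b t ≠ 0) :
    (criticalPoint a b t 0 - 2) / (criticalPoint a b t 1 - 3) = t := by
  simp [criticalPoint, h]

theorem criticalPoint_isCritical {u : Fin 3 → ℂ} {t : ℂ} (ha : u 0 ≠ 0) (hb : u 1 ≠ 0)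
    (hc : u 2 ≠ 0) (hab : u 0 + u 1 ≠ 0)
    (ht : (3 * u 0 + 6 * u 2) * t ^ 3 + (2 * u 1 - 4 * u 2) * t ^ 2 + 15 * u 0 * t
      + 10 * u 1 = 0) :
    (∀ i, criticalPoint (u 0) (u 1) t i ≠ 0) ∧
      eval (criticalPoint (u 0) (u 1) t) umbrella = 0 ∧
      ∃ lam : ℂ, ∀ i, u i = lam * criticalPoint (u 0) (u 1) t i *
        eval (criticalPoint (u 0) (u 1) t) (pderiv i umbrella) := by
  obtain ⟨h0, h23, hY, h5⟩ := slope_nondegenerate hb hc hab ht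
  have hoff := offset_ne_zero hab h0 hY
  have hx : 2 + t * offset (u 0) (u 1) t = -(u 0 * (3 * t - 2)) / (u 0 + u 1) := by
    unfold offset; field_simp; ring
  have hy : 3 + offset (u 0) (u 1) t = u 1 * (3 * t - 2) / ((u 0 + u 1) * t) := by
    unfold offset; field_simp; ring
  have hlin : offset (u 0) (u 1) t * ((u 0 + u 1) * t) = -(3 * u 0 * t + 2 * u 1) := by
    unfold offset; field_simp
  obtain ⟨e0, e1, e2⟩ := eval_pderiv_umbrella (criticalPoint (u 0) (u 1) t)
  refine ⟨?_, ?_, -u 2 / ((5 + t ^ 2) * offset (u 0) (u 1) t ^ 2), ?_⟩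
  · simp only [Fin.forall_fin_succ, criticalPoint]
    simp [hx, hy, ha, hb, hab, h0, h23, h5]
  · rw [eval_umbrella]
    simp [criticalPoint]
    ring
  · have key : (5 + t ^ 2) * (offset (u 0) (u 1) t * (u 0 + u 1))
        = 2 * u 2 * t * (3 * t - 2) := by
      refine mul_left_cancel₀ h0 ?_
      linear_combination (5 + t ^ 2) * hlin - ht
    have c0 : u 0 = -u 2 / ((5 + t ^ 2) * offset (u 0) (u 1) t ^ 2) *
        (2 + t * offset (u 0) (u 1) t) * (2 * (t * offset (u 0) (u 1) t)) := by
      rw [hx]; field_simp; linear_combination key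
    have c1 : u 1 = -u 2 / ((5 + t ^ 2) * offset (u 0) (u 1) t ^ 2) *
        (3 + offset (u 0) (u 1) t) * -(2 * offset (u 0) (u 1) t * t ^ 2) := by
      rw [hy]; field_simp; linear_combination key
    have c2 : u 2 = -u 2 / ((5 + t ^ 2) * offset (u 0) (u 1) t ^ 2) *
        (5 + t ^ 2) * -(offset (u 0) (u 1) t) ^ 2 := by
      field_simp
    intro i
    fin_cases i
    · exact c0.trans (by simp [e0]; simp [criticalPoint])
    · exact c1.trans (by simp [e1]; simp [criticalPoint])
    · exact c2.trans (by simp [e2]; simp [criticalPoint])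

theorem isCritical_eq_criticalPoint {u z : Fin 3 → ℂ} (hb : u 1 ≠ 0)
    (hc : u 2 ≠ 0) (hab : u 0 + u 1 ≠ 0) (hz : eval z umbrella = 0)
    (hlam : ∃ lam : ℂ, ∀ i, u i = lam * z i * eval z (pderiv i umbrella)) :
    ∃ t : ℂ, (3 * u 0 + 6 * u 2) * t ^ 3 + (2 * u 1 - 4 * u 2) * t ^ 2 + 15 * u 0 * t
      + 10 * u 1 = 0 ∧ criticalPoint (u 0) (u 1) t = z := by
  obtain ⟨lam, hl⟩ := hlam
  obtain ⟨e0, e1, e2⟩ := eval_pderiv_umbrella z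
  have l0 := e0 ▸ hl 0
  have l1 := e1 ▸ hl 1
  have l2 := e2 ▸ hl 2
  rw [eval_umbrella] at hz
  have hY : z 1 - 3 ≠ 0 := fun h => hc (by rw [l2, h]; ring)
  have hW : z 2 - 5 ≠ 0 := fun h => hb (by rw [l1, h]; ring)
  obtain ⟨t, ht⟩ : ∃ t, t = (z 0 - 2) / (z 1 - 3) := ⟨_, rfl⟩
  obtain ⟨Y, hYdef⟩ : ∃ Y, Y = z 1 - 3 := ⟨_, rfl⟩
  rw [← hYdef] at hY ht
  have hz1 : z 1 = 3 + Y := by rw [hYdef]; ring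
  have hz0 : z 0 = 2 + t * Y := by rw [ht]; field_simp; ring
  have hz2 : z 2 = 5 + t ^ 2 := by
    have : Y ^ 2 * (z 2 - (5 + t ^ 2)) = 0 := by
      rw [hz0, hz1] at hz; linear_combination -hz
    exact sub_eq_zero.mp ((mul_eq_zero.mp this).resolve_left (pow_ne_zero 2 hY))
  have h0 : t ≠ 0 := by
    rintro rfl
    exact hW (by rw [hz2]; ring)
  rw [hz0] at l0
  rw [hz1, hz2] at l1 l2
  have hlin : Y * ((u 0 + u 1) * t) = -(3 * u 0 * t + 2 * u 1) := by
    linear_combination t * (3 + Y) * l0 + (2 + t * Y) * l1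
  have hoff : offset (u 0) (u 1) t = Y := by
    rw [offset, ← hlin]
    field_simp
  refine ⟨t, ?_, ?_⟩
  · have h1 : u 1 * (5 + t ^ 2) * Y = 2 * u 2 * (3 + Y) * t ^ 2 := by
      linear_combination (5 + t ^ 2) * Y * l1 - 2 * (3 + Y) * t ^ 2 * l2
    refine (mul_eq_zero.mp (?_ : u 1 * _ = 0)).resolve_left hb
    linear_combination (-(u 0 + u 1) * t) * h1
      + (u 1 * (5 + t ^ 2) - 2 * u 2 * t ^ 2) * hlin
  · ext i
    fin_cases i <;> simp [criticalPoint, hoff, hz0, hz1, hz2]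

/-- **The ML degree of the shifted Whitney umbrella is `r₀ = 3`**: for generic
`u ∈ ℂ³` there are exactly `3` ML-critical points on the torus. -/
theorem umbrella_ml_degree :
    ∃ g : MvPolynomial (Fin 3) ℂ, g ≠ 0 ∧
      ∀ u : Fin 3 → ℂ, eval u g ≠ 0 →
        {z : Fin 3 → ℂ | (∀ i, z i ≠ 0) ∧ eval z umbrella = 0 ∧
            ∃ lam : ℂ, ∀ i, u i = lam * z i * eval z (pderiv i umbrella)}.ncard = 3 := by
  refine ⟨X 0 * X 1 * X 2 * (X 0 + X 1) * (3 * X 0 + 6 * X 2) *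
    (slopeCubic (X 0) (X 1) (X 2)).discr, ?_, ?_⟩
  · intro h
    have := congrArg (eval fun _ => (1 : ℂ)) h
    norm_num [slopeCubic, Cubic.discr] at this
  · intro u hu
    have hdisc : eval u (slopeCubic (X 0) (X 1) (X 2)).discr
        = (slopeCubic (u 0) (u 1) (u 2)).discr := by
      simp [slopeCubic, Cubic.discr]
    simp only [map_mul, mul_ne_zero_iff, hdisc] at hu
    simp only [map_add, map_mul, eval_X, map_ofNat] at hu
    obtain ⟨⟨⟨⟨⟨ha, hb⟩, hc⟩, hab⟩, hlead⟩, hd⟩ := hu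
    have hP : (slopeCubic (u 0) (u 1) (u 2)).a ≠ 0 := hlead
    have hcard : (slopeCubic (u 0) (u 1) (u 2)).roots.toFinset.card = 3 := by
      have hid : (slopeCubic (u 0) (u 1) (u 2)).map (RingHom.id ℂ) =
        slopeCubic (u 0) (u 1) (u 2) := rfl
      simpa only [hid] using Cubic.card_roots_of_discr_ne_zero (φ := RingHom.id ℂ) hP
        (IsAlgClosed.splits _) hd
    have hmem (t : ℂ) : t ∈ (slopeCubic (u 0) (u 1) (u 2)).roots.toFinset ↔
        (3 * u 0 + 6 * u 2) * t ^ 3 + (2 * u 1 - 4 * u 2) * t ^ 2 + 15 * u 0 * t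
          + 10 * u 1 = 0 := by
      rw [Multiset.mem_toFinset, Cubic.mem_roots_iff (Cubic.ne_zero_of_a_ne_zero hP)]
      rfl
    rw [← Set.ncard_coe_finset] at hcard
    refine Eq.trans (Eq.symm ?_) hcard
    refine Set.BijOn.ncard_eq (f := criticalPoint (u 0) (u 1)) ⟨?_, ?_, ?_⟩
    · intro t ht
      exact criticalPoint_isCritical ha hb hc hab ((hmem t).mp ht)
    · have hslope (t : ℂ) (ht : t ∈ (slopeCubic (u 0) (u 1) (u 2)).roots.toFinset) :=
        have ⟨h0, _, hY, _⟩ := slope_nondegenerate hb hc hab ((hmem t).mp ht)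
        criticalPoint_slope (offset_ne_zero hab h0 hY)
      intro s hs t ht hst
      rw [← hslope s hs, hst, hslope t ht]
    · rintro z ⟨-, hz, hlam⟩
      obtain ⟨t, ht, rfl⟩ := isCritical_eq_criticalPoint hb hc hab hz hlam
      exact ⟨t, (hmem t).mpr ht, rfl⟩
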